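/- Let d, m ≥ 1, let F : ℝ^d → {1,…,m} be a measurable classifier, let σ_ε > 0, and let ε be distributed according to the isotropic Gaussian measure N(0, σ_ε² I) on ℝ^d. Fix x ∈ ℝ^d, a class c_A ∈ {1,…,m}, and p̲_A ∈ (1/2, 1) such that P_ε(F(x+ε) = c_A) ≥ p̲_A. Then for every δ ∈ ℝ^d with ‖δ‖₂ < σ_ε·Φ⁻¹(p̲_A) and every class c ≠ c_A, one has P_ε(F(x+δ+ε) = c_A) > P_ε(F(x+δ+ε) = c); i.e., the smoothed classifier G satisfies G(x+δ) = c_A with certified radius R = σ_ε·Φ⁻¹(p̲_A). -/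

import Mathlib

open MeasureTheory ProbabilityTheory Set

lemma aux_phi_half (r : ℝ) (hr : 0 < r) : 1 / 2 < (gaussianReal 0 1 (Iic r)).toReal := by
  have hneg : gaussianReal 0 1 (Ici (-r)) = gaussianReal 0 1 (Iic r) := by
    have h := gaussianReal_map_neg (μ := 0) (v := 1)
    rw [neg_zero] at h
    conv_rhs => rw [← h]
    rw [Measure.map_apply (by fun_prop) measurableSet_Iic]
    congr 1
    ext y
    simp only [mem_Ici, mem_preimage, mem_Iic]
    constructor <;> intro h <;> linarith
  have hpos : 0 < (gaussianReal 0 1).real (Ici (-r) ∩ Iic r) := by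
    rw [Measure.real, ENNReal.toReal_pos_iff]
    refine ⟨?_, measure_lt_top _ _⟩
    rw [pos_iff_ne_zero]
    intro h0
    have := gaussianReal_absolutelyContinuous' 0 (v := 1) one_ne_zero h0
    rw [Ici_inter_Iic, Real.volume_Icc, ENNReal.ofReal_eq_zero] at this
    linarith
  have hU := measureReal_union_add_inter (μ := gaussianReal 0 1) (s := Ici (-r)) (t := Iic r)
    measurableSet_Iic
  have huniv : Ici (-r) ∪ Iic r = univ := by
    ext y
    simp only [mem_union, mem_Ici, mem_Iic, mem_univ, iff_true]
    by_contra! h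
    linarith [h.1, h.2]
  rw [huniv, probReal_univ] at hU
  have h1 : (gaussianReal 0 1).real (Ici (-r)) = (gaussianReal 0 1).real (Iic r) := by
    simp only [Measure.real, hneg]
  change _ < (gaussianReal 0 1).real (Iic r)
  linarith

lemma aux_law {d : ℕ} (v : NNReal) (a : Fin d → ℝ) (ha : ∑ i, a i ^ 2 * (v : ℝ) = 1) :
    (Measure.pi fun _ : Fin d => gaussianReal 0 v).map (fun z => ∑ i, a i * z i)
      = gaussianReal 0 1 := by
  have hm : Measurable (fun z : Fin d → ℝ => ∑ i, a i * z i) := by fun_prop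
  have := Measure.isProbabilityMeasure_map
    (μ := Measure.pi fun _ : Fin d => gaussianReal 0 v) hm.aemeasurable
  apply Measure.ext_of_charFun
  ext t
  rw [charFun_apply_real, integral_map hm.aemeasurable (by fun_prop)]
  have h1 : ∀ z : Fin d → ℝ, Complex.exp (t * ((∑ i, a i * z i : ℝ) : ℂ) * Complex.I)
      = ∏ i, Complex.exp (((t * a i : ℝ) : ℂ) * (z i : ℂ) * Complex.I) := by
    intro z
    rw [← Complex.exp_sum]
    congr 1
    push_cast
    rw [Finset.mul_sum, Finset.sum_mul]
    exact Finset.sum_congr rfl fun i _ => by ring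
  simp_rw [h1]
  rw [integral_fintype_prod_eq_prod
    (f := fun i (y : ℝ) ↦ Complex.exp (((t * a i : ℝ) : ℂ) * (y : ℂ) * Complex.I))]
  simp_rw [← charFun_apply_real, charFun_gaussianReal]
  rw [← Complex.exp_sum]
  congr 1
  have ha' : ∑ i, (a i : ℂ) ^ 2 * ((v : ℝ) : ℂ) = 1 := by exact_mod_cast ha
  have : ∀ i, (((t * a i : ℝ) : ℂ) * ((0 : ℝ) : ℂ) * Complex.I
      - ((v : ℝ) : ℂ) * ((t * a i : ℝ) : ℂ) ^ 2 / 2)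
      = (-(t : ℂ) ^ 2 / 2) * ((a i : ℂ) ^ 2 * ((v : ℝ) : ℂ)) := by
    intro i; push_cast; ring
  simp_rw [this]
  rw [← Finset.mul_sum, ha']
  push_cast
  ring

lemma aux_shift_one (v : NNReal) (hv : v ≠ 0) (b : ℝ) :
    gaussianReal b v = (gaussianReal 0 v).withDensity
      (fun y => ENNReal.ofReal (Real.exp ((2 * b * y - b ^ 2) / (2 * v)))) := by
  rw [gaussianReal_of_var_ne_zero _ hv, gaussianReal_of_var_ne_zero _ hv,
    ← withDensity_mul _ (measurable_gaussianPDF _ _) (by fun_prop)]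
  congr 1
  ext y
  have hv' : (v : ℝ) ≠ 0 := by exact_mod_cast hv
  rw [Pi.mul_apply, gaussianPDF, gaussianPDF, ← ENNReal.ofReal_mul (gaussianPDFReal_nonneg _ _ _),
    gaussianPDFReal, gaussianPDFReal, mul_assoc _ (Real.exp _) (Real.exp _), ← Real.exp_add]
  congr 3
  field_simp
  ring

lemma aux_shift {d : ℕ} (v : NNReal) (hv : v ≠ 0) (b : Fin d → ℝ) :
    (Measure.pi fun _ : Fin d => gaussianReal 0 v).map (fun z => b + z)
     = (Measure.pi fun _ : Fin d => gaussianReal 0 v).withDensity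
      (fun z => ENNReal.ofReal (Real.exp ((2 * ∑ i, b i * z i - ∑ i, b i ^ 2) / (2 * v)))) := by
  have e1 : (Measure.pi fun _ : Fin d => gaussianReal 0 v).map (fun z => b + z)
      = Measure.pi fun i : Fin d => gaussianReal (b i) v := by
    have h2 : ∀ i, (gaussianReal 0 v).map (fun y => b i + y) = gaussianReal (b i) v := by
      intro i; rw [gaussianReal_map_const_add]; simp
    have : ∀ i, SigmaFinite ((gaussianReal 0 v).map (fun y => b i + y)) := by
      intro i; rw [h2]; infer_instance
    have h := Measure.pi_map_pi (μ := fun _ : Fin d => gaussianReal 0 v)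
      (f := fun i y => b i + y) (fun i => by fun_prop)
    simp_rw [h2] at h
    exact h
  rw [e1]
  apply Measure.pi_eq
  intro s hs
  set f : Fin d → ℝ → ENNReal := fun i y =>
    ENNReal.ofReal (Real.exp ((2 * b i * y - b i ^ 2) / (2 * v))) with hf
  have hfm : ∀ i, Measurable (f i) := fun i => by fun_prop
  have hprod : ∀ z : Fin d → ℝ,
      ENNReal.ofReal (Real.exp ((2 * ∑ i, b i * z i - ∑ i, b i ^ 2) / (2 * v)))
        = ∏ i, f i (z i) := by
    intro z
    simp only [hf]
    rw [← ENNReal.ofReal_prod_of_nonneg (fun i _ => (Real.exp_pos _).le), ← Real.exp_sum]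
    congr 2
    rw [← Finset.sum_div, Finset.mul_sum, ← Finset.sum_sub_distrib]
    congr 1
    exact Finset.sum_congr rfl fun i _ => by ring
  simp_rw [hprod]
  rw [withDensity_apply _ (.univ_pi hs), ← lintegral_indicator (.univ_pi hs)]
  have hind : ∀ z : Fin d → ℝ, (univ.pi s).indicator (fun z => ∏ i, f i (z i)) z
      = ∏ i, (s i).indicator (f i) (z i) := by
    intro z
    by_cases hz : z ∈ univ.pi s
    · rw [indicator_of_mem hz]
      exact Finset.prod_congr rfl fun i _ => (indicator_of_mem (hz i (mem_univ i)) _).symm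
    · rw [indicator_of_notMem hz]
      simp only [mem_univ_pi, not_forall] at hz
      obtain ⟨i, hi⟩ := hz
      exact (Finset.prod_eq_zero (Finset.mem_univ i) (indicator_of_notMem hi _)).symm
  simp_rw [hind]
  have hgm : ∀ i, Measurable ((s i).indicator (f i)) := fun i => (hfm i).indicator (hs i)
  have hI : iIndepFun (fun i (z : Fin d → ℝ) => (s i).indicator (f i) (z i))
      (Measure.pi fun _ : Fin d => gaussianReal 0 v) :=
    iIndepFun_pi (X := fun i => (s i).indicator (f i)) (fun i => (hgm i).aemeasurable)
  rw [lintegral_prod_eq_prod_lintegral_of_indepFun Finset.univ _ hI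
    (fun i => (hgm i).comp (measurable_pi_apply i))]
  refine Finset.prod_congr rfl fun i _ => ?_
  rw [(measurePreserving_eval (fun _ : Fin d => gaussianReal 0 v) i).lintegral_comp (hgm i),
    lintegral_indicator (hs i), aux_shift_one v hv (b i), withDensity_apply _ (hs i)]

/-- Neyman-Pearson. -/
lemma aux_np {α : Type*} [MeasurableSpace α] (μ : Measure α) [IsProbabilityMeasure μ]
    (f : α → ENNReal) (k : ENNReal) (A H : Set α)
    (hA : MeasurableSet A) (hH : MeasurableSet H)
    (h1 : ∀ z ∈ H, f z ≤ k) (h2 : ∀ z, z ∉ H → k ≤ f z) (hle : μ H ≤ μ A) :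
    μ.withDensity f H ≤ μ.withDensity f A := by
  have hd : μ (H \ A) ≤ μ (A \ H) := by
    have e1 := measure_inter_add_sdiff (μ := μ) H hA
    have e2 := measure_inter_add_sdiff (μ := μ) A hH
    rw [← e1, ← e2, inter_comm A H] at hle
    exact (ENNReal.add_le_add_iff_left (measure_ne_top _ _)).1 hle
  rw [← measure_inter_add_sdiff (μ := μ.withDensity f) H hA,
    ← measure_inter_add_sdiff (μ := μ.withDensity f) A hH, inter_comm A H]
  gcongr 1
  calc μ.withDensity f (H \ A) = ∫⁻ z in H \ A, f z ∂μ := withDensity_apply _ (hH.diff hA)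
    _ ≤ ∫⁻ _ in H \ A, k ∂μ := setLIntegral_mono' (hH.diff hA) fun z hz => h1 z hz.1
    _ = k * μ (H \ A) := setLIntegral_const _ _
    _ ≤ k * μ (A \ H) := by gcongr
    _ = ∫⁻ _ in A \ H, k ∂μ := (setLIntegral_const _ _).symm
    _ ≤ ∫⁻ z in A \ H, f z ∂μ := setLIntegral_mono' (hA.diff hH) fun z hz => h2 z hz.2
    _ = _ := (withDensity_apply _ (hA.diff hH)).symm

/-- **Randomized smoothing certification as used by CERTIFY.**
If the base classifier `F` classifies the Gaussian-perturbed input `x + ε` as `cA`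
with probability at least `p̲A > 1/2`, then for every perturbation `δ` with
`‖δ‖₂ < σε·Φ⁻¹(p̲A)` the smoothed classifier at `x + δ` assigns strictly larger
probability to `cA` than to any other class. -/
theorem randomized_smoothing_certify_radius
    (d m : ℕ) (hd : 1 ≤ d) (hm : 1 ≤ m)
    (F : (Fin d → ℝ) → Fin m) (hF : Measurable F)
    (σε : ℝ) (hσε : 0 < σε)
    -- `Φ` is the standard normal CDF
    (Φ : ℝ → ℝ)
    (hΦ : ∀ t : ℝ, Φ t = (gaussianReal 0 1 (Iic t)).toReal)
    -- `Φinv` is its inverse on (0,1) (the standard normal quantile function)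
    (Φinv : ℝ → ℝ)
    (hΦinv : ∀ p ∈ Ioo (0:ℝ) 1, Φ (Φinv p) = p)
    -- the isotropic Gaussian noise measure N(0, σε² I) on ℝ^d
    (μ : Measure (Fin d → ℝ))
    (hμ : μ = Measure.pi fun _ : Fin d => gaussianReal 0 (Real.toNNReal (σε ^ 2)))
    (x : Fin d → ℝ) (cA : Fin m) (pA : ℝ)
    (hpA : pA ∈ Ioo (1/2 : ℝ) 1)
    (hlow : pA ≤ (μ {ε | F (x + ε) = cA}).toReal)
    (δ : Fin d → ℝ) (hδ : Real.sqrt (∑ i, (δ i) ^ 2) < σε * Φinv pA) :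
    ∀ c : Fin m, c ≠ cA →
      (μ {ε | F (x + δ + ε) = c}).toReal < (μ {ε | F (x + δ + ε) = cA}).toReal := by
  have hv : Real.toNNReal (σε ^ 2) ≠ 0 := by
    rw [Ne, Real.toNNReal_eq_zero, not_le]; positivity
  have hvr : ((Real.toNNReal (σε ^ 2) : NNReal) : ℝ) = σε ^ 2 := Real.coe_toNNReal _ (sq_nonneg _)
  have : IsProbabilityMeasure μ := by rw [hμ]; infer_instance
  obtain ⟨hp1, hp2⟩ := hpA
  have hmeas : ∀ (y : Fin d → ℝ) (c : Fin m), MeasurableSet {ε | F (y + ε) = c} := fun y c =>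
    (hF.comp (measurable_const_add y)) (measurableSet_singleton c)
  -- it suffices to prove that class `cA` keeps probability above one half
  have key : 1 / 2 < μ.real {ε | F (x + δ + ε) = cA} := by
    set s := Real.sqrt (∑ i, (δ i) ^ 2) with hs
    have hs0 : 0 ≤ s := Real.sqrt_nonneg _
    have hss : ∑ i, (δ i) ^ 2 = s ^ 2 :=
      (Real.sq_sqrt (Finset.sum_nonneg fun i _ => sq_nonneg _)).symm
    rcases hs0.eq_or_lt with h0 | hspos
    · have hδ0 : δ = 0 := by
        rw [← h0, zero_pow two_ne_zero] at hss
        ext i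
        have := (Finset.sum_eq_zero_iff_of_nonneg (fun i _ => sq_nonneg (δ i))).1 hss i
          (Finset.mem_univ i)
        simpa using this
      rw [hδ0, add_zero]
      exact lt_of_lt_of_le hp1 hlow
    · set q := Φinv pA with hq
      have hΦq : (gaussianReal 0 1).real (Iic q) = pA := by
        have := hΦinv pA ⟨by linarith, hp2⟩
        rwa [hΦ] at this
      set a : Fin d → ℝ := fun i => δ i / (σε * s) with ha
      have hlaw : μ.map (fun z => ∑ i, a i * z i) = gaussianReal 0 1 := by
        rw [hμ]
        apply aux_law
        rw [hvr, ← Finset.sum_mul]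
        simp only [ha, div_pow]
        rw [← Finset.sum_div, hss]
        field_simp
      have hLm : Measurable (fun z : Fin d → ℝ => ∑ i, a i * z i) := by fun_prop
      have hLδ : ∀ z : Fin d → ℝ, ∑ i, δ i * z i = σε * s * ∑ i, a i * z i := by
        intro z
        rw [Finset.mul_sum]
        refine Finset.sum_congr rfl fun i _ => ?_
        simp only [ha]
        field_simp
      set A : Set (Fin d → ℝ) := {ε | F (x + ε) = cA} with hA
      set H : Set (Fin d → ℝ) := (fun z => ∑ i, a i * z i) ⁻¹' Iic q with hH
      have hHm : MeasurableSet H := hLm measurableSet_Iic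
      have hAm : MeasurableSet A := hmeas x cA
      have hμH : μ H = gaussianReal 0 1 (Iic q) := by
        rw [← hlaw, Measure.map_apply hLm measurableSet_Iic]
      have hle : μ H ≤ μ A := by
        rw [hμH, ← ENNReal.toReal_le_toReal (measure_ne_top _ _) (measure_ne_top _ _)]
        exact hΦq.le.trans hlow
      have hshift := aux_shift (Real.toNNReal (σε ^ 2)) hv δ
      rw [← hμ, hvr, hss] at hshift
      have hnp := aux_np μ
        (fun z => ENNReal.ofReal (Real.exp ((2 * ∑ i, δ i * z i - s ^ 2) / (2 * σε ^ 2))))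
        (ENNReal.ofReal (Real.exp ((2 * (σε * s * q) - s ^ 2) / (2 * σε ^ 2)))) A H hAm hHm
        (by
          intro z hz
          rw [hH, mem_preimage, mem_Iic] at hz
          rw [hLδ]
          gcongr)
        (by
          intro z hz
          rw [hH, mem_preimage, mem_Iic, not_le] at hz
          rw [hLδ]
          gcongr) hle
      rw [← hshift, Measure.map_apply (measurable_const_add δ) hHm,
        Measure.map_apply (measurable_const_add δ) hAm] at hnp
      have hAe : (fun z => δ + z) ⁻¹' A = {ε | F (x + δ + ε) = cA} := by
        ext z; simp [hA, add_assoc]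
      have hHe : (fun z => δ + z) ⁻¹' H
          = (fun z => ∑ i, a i * z i) ⁻¹' Iic (q - s / σε) := by
        ext z
        have e : ∑ i, a i * δ i = s / σε := by
          have : ∀ i, a i * δ i = δ i ^ 2 / (σε * s) := fun i => by simp only [ha]; ring
          simp_rw [this]
          rw [← Finset.sum_div, hss]
          field_simp
        simp only [hH, mem_preimage, mem_Iic, Pi.add_apply, mul_add, Finset.sum_add_distrib, e]
        constructor <;> intro h <;> linarith
      rw [hAe, hHe, ← Measure.map_apply hLm measurableSet_Iic, hlaw] at hnp
      have hr : 0 < q - s / σε := by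
        rw [sub_pos, div_lt_iff₀ hσε]; linarith
      exact lt_of_lt_of_le (aux_phi_half _ hr)
        (ENNReal.toReal_mono (measure_ne_top _ _) hnp)
  intro c hc
  have hdisj : Disjoint {ε | F (x + δ + ε) = c} {ε | F (x + δ + ε) = cA} := by
    rw [Set.disjoint_left]
    intro z hz hz'
    exact hc (hz.symm.trans hz')
  have hU := measureReal_union (μ := μ) hdisj (hmeas (x + δ) cA)
  have h1 : μ.real ({ε | F (x + δ + ε) = c} ∪ {ε | F (x + δ + ε) = cA}) ≤ 1 := measureReal_le_one
  change μ.real _ < μ.real _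
  linarith
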